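/- Let q ∈ (0,∞) with q ≠ 1 and r ∈ (0,4], and suppose p ∈ (0,1) is a fixed point of Φ_{q,r} = φ_q ∘ f_r that is locally asymptotically stable. Then p is globally asymptotically stable (i.e., Φ_{q,r}ⁿ(x) → p for every x ∈ (0,1)) if and only if the fixed point 0 is not locally asymptotically stable. -/

import Mathlib

open Real Set Filter

/-- The q-deformation φ_q(x) = (1 - q^x)/(1 - q). -/
noncomputable def phi (q x : ℝ) : ℝ := (1 - q ^ x) / (1 - q)

/-- The logistic map f_r(x) = r·x·(1-x). -/
noncomputable def logistic (r x : ℝ) : ℝ := r * x * (1 - x)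

/-- The q-deformed logistic map Φ_{q,r} = φ_q ∘ f_r. -/
noncomputable def Phi (q r x : ℝ) : ℝ := phi q (logistic r x)

/-- A fixed point `x₀` of `g : [0,1] → [0,1]` is locally asymptotically stable:
(i) for every `ε > 0` there is a neighborhood `V` of `x₀` in `[0,1]` with
`|gⁿ(x) - x₀| < ε` for all `x ∈ V` and all `n`; (ii) there is a neighborhood `V` of `x₀`
in `[0,1]` such that `gⁿ(x) → x₀` for all `x ∈ V`. -/
def LAS (g : ℝ → ℝ) (x₀ : ℝ) : Prop :=
  (∀ ε > 0, ∃ V ∈ nhdsWithin x₀ (Set.Icc (0:ℝ) 1),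
    ∀ x ∈ V ∩ Set.Icc (0:ℝ) 1, ∀ n : ℕ, |g^[n] x - x₀| < ε) ∧
  (∃ V ∈ nhdsWithin x₀ (Set.Icc (0:ℝ) 1),
    ∀ x ∈ V ∩ Set.Icc (0:ℝ) 1,
      Filter.Tendsto (fun n : ℕ => g^[n] x) Filter.atTop (nhds x₀))

/-! ### Expansion of cross-ratios

For `a, b, c, d` write `(d - a) (c - b) / ((b - a) (d - c))` for the cross-ratio. Maps with negative
Schwarzian derivative increase it along monotone quadruples; for `Phi q r` we show this directly. -/

/-- `(a', b', c', d')` has strictly larger cross-ratio than `(a, b, c, d)`, denominators cleared. -/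
def CrossExpands (a b c d a' b' c' d' : ℝ) : Prop :=
  (d - a) * (c - b) * ((b' - a') * (d' - c')) < (d' - a') * (c' - b') * ((b - a) * (d - c))

lemma sinh_le_mul_cosh {t : ℝ} (ht : 0 ≤ t) : Real.sinh t ≤ t * Real.cosh t := by
  have hmono : MonotoneOn (fun t : ℝ => t * Real.cosh t - Real.sinh t) (Set.Ici 0) := by
    refine monotoneOn_of_deriv_nonneg (convex_Ici 0) (by fun_prop) (by fun_prop) ?_
    intro x hx
    rw [interior_Ici, Set.mem_Ioi] at hx
    have hd : HasDerivAt (fun t : ℝ => t * Real.cosh t - Real.sinh t)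
        (1 * Real.cosh x + x * Real.sinh x - Real.cosh x) x :=
      ((hasDerivAt_id x).mul (Real.hasDerivAt_cosh x)).sub (Real.hasDerivAt_sinh x)
    rw [hd.deriv]
    nlinarith [mul_pos hx (Real.sinh_pos_iff.2 hx)]
  have h := hmono (Set.mem_Ici.2 le_rfl) (Set.mem_Ici.2 ht) ht
  simp only [Real.sinh_zero, zero_mul, sub_zero] at h
  linarith

lemma mul_sinh_le_mul_sinh_add {x y : ℝ} (hx : 0 ≤ x) (hy : 0 ≤ y) :
    (x + y) * Real.sinh x ≤ x * Real.sinh (x + y) := by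
  rw [Real.sinh_add]
  have h1 := sinh_le_mul_cosh hx
  have h2 := Real.self_le_sinh_iff.2 hy
  have h3 := Real.one_le_cosh y
  have h4 := Real.sinh_nonneg_iff.2 hx
  have h5 := Real.one_le_cosh x
  have h6 : x * Real.sinh x ≤ x * Real.sinh x * Real.cosh y :=
    le_mul_of_one_le_right (mul_nonneg hx h4) h3
  have h7 : y * Real.sinh x ≤ y * (x * Real.cosh x) := mul_le_mul_of_nonneg_left h1 hy
  have h8 : x * Real.cosh x * y ≤ x * Real.cosh x * Real.sinh y :=
    mul_le_mul_of_nonneg_left h2 (by positivity)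
  linarith

lemma add_mul_sinh_mul_sinh_le {x y : ℝ} (hx : 0 ≤ x) (hy : 0 ≤ y) :
    (x + y) * (Real.sinh x * Real.sinh y) ≤ x * y * Real.sinh (x + y) := by
  rw [Real.sinh_add]
  have h1 := sinh_le_mul_cosh hx
  have h2 := sinh_le_mul_cosh hy
  have h3 := Real.sinh_nonneg_iff.2 hx
  have h4 := Real.sinh_nonneg_iff.2 hy
  have h5 := mul_le_mul_of_nonneg_left h2 (mul_nonneg hx h3)
  have h6 := mul_le_mul_of_nonneg_left h1 (mul_nonneg hy h4)
  linarith

lemma sinh_cross_ratio_le {x y z : ℝ} (hx : 0 ≤ x) (hy : 0 ≤ y) (hz : 0 ≤ z) :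
    (x + y + z) * y * (Real.sinh x * Real.sinh z) ≤
      Real.sinh (x + y + z) * Real.sinh y * (x * z) := by
  have hsx := Real.sinh_nonneg_iff.2 hx
  have hsz := Real.sinh_nonneg_iff.2 hz
  have h1 := Real.self_le_sinh_iff.2 hy
  have h2 : (x + z) * (Real.sinh x * Real.sinh z) ≤ x * z * Real.sinh (x + z) :=
    add_mul_sinh_mul_sinh_le hx hz
  have h3 := mul_sinh_le_mul_sinh_add (add_nonneg hx hz) hy
  have h4 : (x + y + z) * (Real.sinh x * Real.sinh z) ≤ x * z * Real.sinh (x + y + z) := by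
    rcases eq_or_lt_of_le (add_nonneg hx hz) with h0 | h0
    · have hx0 : x = 0 := by linarith
      simp [hx0]
    · refine le_of_mul_le_mul_left ?_ h0
      have e : x + z + y = x + y + z := by ring
      rw [e] at h3
      have h5 := mul_le_mul_of_nonneg_left h2 (by positivity : 0 ≤ x + y + z)
      have h6 := mul_le_mul_of_nonneg_left h3 (mul_nonneg hx hz)
      linarith
  have h7 : 0 ≤ x * z * Real.sinh (x + y + z) :=
    mul_nonneg (mul_nonneg hx hz) (Real.sinh_nonneg_iff.2 (by positivity))
  have h8 := mul_le_mul_of_nonneg_left h1 h7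
  have h9 := mul_le_mul_of_nonneg_right h4 hy
  linarith

lemma exp_sub_exp_eq_sinh (x y : ℝ) :
    Real.exp y - Real.exp x = 2 * Real.exp ((x + y) / 2) * Real.sinh ((y - x) / 2) := by
  have h1 : Real.exp y = Real.exp ((x + y) / 2) * Real.exp ((y - x) / 2) := by
    rw [← Real.exp_add]; ring_nf
  have h2 : Real.exp x = Real.exp ((x + y) / 2) * Real.exp (-((y - x) / 2)) := by
    rw [← Real.exp_add]; ring_nf
  rw [Real.sinh_eq, h1, h2]; ring

lemma exp_cross_ratio_le {a b c d : ℝ} (hab : a ≤ b) (hbc : b ≤ c) (hcd : c ≤ d) :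
    (d - a) * (c - b) * ((Real.exp b - Real.exp a) * (Real.exp d - Real.exp c)) ≤
      (Real.exp d - Real.exp a) * (Real.exp c - Real.exp b) * ((b - a) * (d - c)) := by
  have h := sinh_cross_ratio_le (x := (b - a) / 2) (y := (c - b) / 2) (z := (d - c) / 2)
    (by linarith) (by linarith) (by linarith)
  have e : (b - a) / 2 + (c - b) / 2 + (d - c) / 2 = (d - a) / 2 := by ring
  rw [e] at h
  simp only [exp_sub_exp_eq_sinh]
  have e1 : Real.exp ((a + b) / 2) * Real.exp ((c + d) / 2) = Real.exp ((a + b + c + d) / 2) := by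
    rw [← Real.exp_add]; ring_nf
  have e2 : Real.exp ((a + d) / 2) * Real.exp ((b + c) / 2) = Real.exp ((a + b + c + d) / 2) := by
    rw [← Real.exp_add]; ring_nf
  have h' := mul_le_mul_of_nonneg_left h (Real.exp_pos ((a + b + c + d) / 2)).le
  calc _ = 16 * (Real.exp ((a + b) / 2) * Real.exp ((c + d) / 2) * ((d - a) / 2 * ((c - b) / 2) *
        (Real.sinh ((b - a) / 2) * Real.sinh ((d - c) / 2)))) := by ring
    _ ≤ 16 * (Real.exp ((a + d) / 2) * Real.exp ((b + c) / 2) * (Real.sinh ((d - a) / 2) *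
        Real.sinh ((c - b) / 2) * ((b - a) / 2 * ((d - c) / 2)))) := by
      rw [e1, e2]; linarith
    _ = _ := by ring

lemma phi_cross_ratio_le_of_le {q a b c d : ℝ} (hq : 0 < q) (hq1 : q ≠ 1)
    (hab : a ≤ b) (hbc : b ≤ c) (hcd : c ≤ d) :
    (d - a) * (c - b) * ((phi q b - phi q a) * (phi q d - phi q c)) ≤
      (phi q d - phi q a) * (phi q c - phi q b) * ((b - a) * (d - c)) := by
  have hs : ∀ x y, phi q y - phi q x =
      (Real.exp (Real.log q * y) - Real.exp (Real.log q * x)) / (q - 1) := by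
    intro x y
    have h1 : 1 - q ≠ 0 := sub_ne_zero.2 hq1.symm
    have h2 : q - 1 ≠ 0 := sub_ne_zero.2 hq1
    rw [phi, phi, Real.rpow_def_of_pos hq, Real.rpow_def_of_pos hq]
    field_simp
    ring
  have hl : Real.log q ≠ 0 := Real.log_ne_zero_of_pos_of_ne_one hq hq1
  have key : (Real.log q * d - Real.log q * a) * (Real.log q * c - Real.log q * b) *
      ((Real.exp (Real.log q * b) - Real.exp (Real.log q * a)) *
        (Real.exp (Real.log q * d) - Real.exp (Real.log q * c))) ≤
      (Real.exp (Real.log q * d) - Real.exp (Real.log q * a)) *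
        (Real.exp (Real.log q * c) - Real.exp (Real.log q * b)) *
      ((Real.log q * b - Real.log q * a) * (Real.log q * d - Real.log q * c)) := by
    rcases lt_or_gt_of_ne hl with h | h
    · have := exp_cross_ratio_le (mul_le_mul_of_nonpos_left hcd h.le)
        (mul_le_mul_of_nonpos_left hbc h.le) (mul_le_mul_of_nonpos_left hab h.le)
      linarith
    · exact exp_cross_ratio_le (mul_le_mul_of_nonneg_left hab h.le)
        (mul_le_mul_of_nonneg_left hbc h.le) (mul_le_mul_of_nonneg_left hcd h.le)
  simp only [hs]
  have hpos : 0 < (Real.log q) ^ 2 := by positivity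
  have h2 : 0 < (q - 1) ^ 2 := by have := sub_ne_zero.2 hq1; positivity
  have h3 : q - 1 ≠ 0 := sub_ne_zero.2 hq1
  generalize Real.exp (Real.log q * a) = A at *
  generalize Real.exp (Real.log q * b) = B at *
  generalize Real.exp (Real.log q * c) = C at *
  generalize Real.exp (Real.log q * d) = D at *
  have key' : (d - a) * (c - b) * ((B - A) * (D - C)) ≤ (D - A) * (C - B) * ((b - a) * (d - c)) := by
    refine le_of_mul_le_mul_left ?_ hpos
    linarith
  calc _ = (d - a) * (c - b) * ((B - A) * (D - C)) / (q - 1) ^ 2 := by field_simp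
    _ ≤ (D - A) * (C - B) * ((b - a) * (d - c)) / (q - 1) ^ 2 := by gcongr
    _ = _ := by field_simp

lemma logistic_crossExpands {r a b c d : ℝ} (hr : 0 < r) (hab : a < b) (hbc : b < c) (hcd : c < d) :
    CrossExpands a b c d (logistic r a) (logistic r b) (logistic r c) (logistic r d) := by
  have hs : ∀ x y, logistic r y - logistic r x = r * (y - x) * (1 - x - y) := by
    intro x y; unfold logistic; ring
  unfold CrossExpands
  simp only [hs]
  have h1 : (1 - a - b) * (1 - c - d) < (1 - a - d) * (1 - b - c) := by
    nlinarith [mul_pos (sub_pos.2 (hab.trans hbc)) (sub_pos.2 (hbc.trans hcd))]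
  have h2 : 0 < r ^ 2 * ((d - a) * (c - b) * ((b - a) * (d - c))) := by
    have := sub_pos.2 hab
    have := sub_pos.2 hbc
    have := sub_pos.2 hcd
    have := sub_pos.2 (hab.trans (hbc.trans hcd))
    positivity
  have := mul_lt_mul_of_pos_left h1 h2
  linarith

lemma logistic_strictMonoOn {r : ℝ} (hr : 0 < r) : StrictMonoOn (logistic r) (Set.Iic (1 / 2)) := by
  intro x hx y hy hxy
  simp only [Set.mem_Iic] at hx hy
  unfold logistic
  nlinarith [mul_pos hr (mul_pos (sub_pos.2 hxy) (by linarith : 0 < 1 - x - y))]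

lemma logistic_strictAntiOn {r : ℝ} (hr : 0 < r) : StrictAntiOn (logistic r) (Set.Ici (1 / 2)) := by
  intro x hx y hy hxy
  simp only [Set.mem_Ici] at hx hy
  unfold logistic
  nlinarith [mul_pos hr (mul_pos (sub_pos.2 hxy) (by linarith : 0 < x + y - 1))]

lemma phi_strictMono {q : ℝ} (hq : 0 < q) (hq1 : q ≠ 1) : StrictMono (phi q) := by
  intro x y hxy
  unfold phi
  rcases lt_or_gt_of_ne hq1 with h | h
  · have := Real.rpow_lt_rpow_of_exponent_gt hq h hxy
    exact div_lt_div_of_pos_right (by linarith) (by linarith)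
  · have := Real.rpow_lt_rpow_of_exponent_lt h hxy
    exact div_lt_div_of_neg_of_lt (by linarith) (by linarith)

lemma phi_zero (q : ℝ) : phi q 0 = 0 := by simp [phi]

section

variable {q r : ℝ}

lemma continuous_Phi (hq : 0 < q) : Continuous (Phi q r) := by
  unfold Phi phi logistic
  exact (continuous_const.sub ((Real.continuous_const_rpow hq.ne').comp
    (by fun_prop))).div_const _

lemma Phi_zero : Phi q r 0 = 0 := by simp [Phi, logistic, phi_zero]

lemma Phi_strictMonoOn (hq : 0 < q) (hq1 : q ≠ 1) (hr : 0 < r) :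
    StrictMonoOn (Phi q r) (Set.Iic (1 / 2)) :=
  (phi_strictMono hq hq1).comp_strictMonoOn (logistic_strictMonoOn hr)

lemma Phi_strictAntiOn (hq : 0 < q) (hq1 : q ≠ 1) (hr : 0 < r) :
    StrictAntiOn (Phi q r) (Set.Ici (1 / 2)) :=
  (phi_strictMono hq hq1).comp_strictAntiOn (logistic_strictAntiOn hr)

lemma Phi_le_Phi_half (hq : 0 < q) (hq1 : q ≠ 1) (hr : 0 < r) (x : ℝ) :
    Phi q r x ≤ Phi q r (1 / 2) := by
  rcases le_total x (1 / 2) with h | h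
  · exact (Phi_strictMonoOn hq hq1 hr).monotoneOn h Set.self_mem_Iic h
  · exact (Phi_strictAntiOn hq hq1 hr).antitoneOn Set.self_mem_Ici h h

lemma Phi_pos (hq : 0 < q) (hq1 : q ≠ 1) (hr : 0 < r) {x : ℝ} (hx : x ∈ Set.Ioo (0 : ℝ) 1) :
    0 < Phi q r x := by
  rw [← phi_zero q]
  refine phi_strictMono hq hq1 ?_
  exact mul_pos (mul_pos hr hx.1) (sub_pos.2 hx.2)

lemma Phi_crossExpands (hq : 0 < q) (hq1 : q ≠ 1) (hr : 0 < r) {a b c d : ℝ}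
    (hab : a < b) (hbc : b < c) (hcd : c < d) (hside : d ≤ 1 / 2 ∨ 1 / 2 ≤ a) :
    CrossExpands a b c d (Phi q r a) (Phi q r b) (Phi q r c) (Phi q r d) := by
  have hf := logistic_crossExpands hr hab hbc hcd
  unfold CrossExpands at hf ⊢
  unfold Phi
  have hphi := phi_strictMono hq hq1
  have hM : 0 < (b - a) * (d - c) := mul_pos (sub_pos.2 hab) (sub_pos.2 hcd)
  suffices h : (logistic r d - logistic r a) * (logistic r c - logistic r b) *
        ((phi q (logistic r b) - phi q (logistic r a)) *
          (phi q (logistic r d) - phi q (logistic r c))) ≤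
      (phi q (logistic r d) - phi q (logistic r a)) *
        (phi q (logistic r c) - phi q (logistic r b)) *
        ((logistic r b - logistic r a) * (logistic r d - logistic r c)) ∧
      0 < (logistic r b - logistic r a) * (logistic r d - logistic r c) ∧
      0 < (phi q (logistic r b) - phi q (logistic r a)) *
          (phi q (logistic r d) - phi q (logistic r c)) by
    obtain ⟨h1, h2, h3⟩ := h
    refine lt_of_mul_lt_mul_left ?_ h2.le
    have h4 := mul_le_mul_of_nonneg_right h1 hM.le
    have h5 := mul_lt_mul_of_pos_right hf h3
    linarith
  rcases hside with h | h
  · have m := logistic_strictMonoOn hr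
    have hc : c ≤ 1 / 2 := hcd.le.trans h
    have hb : b ≤ 1 / 2 := hbc.le.trans hc
    have h1 := m (hab.le.trans hb) hb hab
    have h2 := m hb hc hbc
    have h3 := m hc h hcd
    refine ⟨phi_cross_ratio_le_of_le hq hq1 h1.le h2.le h3.le, ?_, ?_⟩
    · exact mul_pos (sub_pos.2 h1) (sub_pos.2 h3)
    · exact mul_pos (sub_pos.2 (hphi h1)) (sub_pos.2 (hphi h3))
  · have m := logistic_strictAntiOn hr
    have hb : 1 / 2 ≤ b := h.trans hab.le
    have hc : 1 / 2 ≤ c := hb.trans hbc.le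
    have h1 := m h hb hab
    have h2 := m hb hc hbc
    have h3 := m hc (hc.trans hcd.le) hcd
    refine ⟨?_, ?_, ?_⟩
    · have := phi_cross_ratio_le_of_le hq hq1 h3.le h2.le h1.le
      linarith
    · exact mul_pos_of_neg_of_neg (sub_neg.2 h1) (sub_neg.2 h3)
    · exact mul_pos_of_neg_of_neg (sub_neg.2 (hphi h1)) (sub_neg.2 (hphi h3))

end

/-- The cross-ratio does not increase when the inner interval shrinks and the outer one grows. -/
lemma not_crossExpands {a b c d a' b' c' d' : ℝ} (hab : a < b) (hbc : b < c) (hcd : c < d)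
    (ha : a' ≤ a) (hb : b ≤ b') (hc : c' ≤ c) (hd : d ≤ d') :
    ¬ CrossExpands a b c d a' b' c' d' := by
  unfold CrossExpands
  rw [not_lt]
  obtain ⟨P, hP, rfl⟩ : ∃ P, 0 < P ∧ b = a + P := ⟨b - a, by linarith, by ring⟩
  obtain ⟨Q, hQ, rfl⟩ : ∃ Q, 0 < Q ∧ d = c + Q := ⟨d - c, by linarith, by ring⟩
  obtain ⟨u, hu, rfl⟩ : ∃ u, 0 ≤ u ∧ a' = a - u := ⟨a - a', by linarith, by ring⟩
  obtain ⟨v, hv, rfl⟩ : ∃ v, 0 ≤ v ∧ d' = c + Q + v := ⟨d' - (c + Q), by linarith, by ring⟩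
  have hL : P + Q ≤ c + Q - a := by linarith
  have h1 : (c + Q + v - (a - u)) * (P * Q) ≤ (c + Q - a) * ((P + u) * (Q + v)) := by
    have : P * (u * Q) ≤ (c + Q - a) * (u * Q) :=
      mul_le_mul_of_nonneg_right (by linarith) (by positivity)
    have : Q * (P * v) ≤ (c + Q - a) * (P * v) :=
      mul_le_mul_of_nonneg_right (by linarith) (by positivity)
    have : 0 ≤ (c + Q - a) * (u * v) := mul_nonneg (by linarith) (by positivity)
    linarith
  have h2 : (P + u) * (Q + v) ≤ (b' - (a - u)) * (c + Q + v - c') :=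
    mul_le_mul (by linarith) (by linarith) (by linarith) (by linarith)
  have h3 : (c + Q + v - (a - u)) * (P * Q) ≤
      (c + Q - a) * ((b' - (a - u)) * (c + Q + v - c')) :=
    h1.trans (mul_le_mul_of_nonneg_left h2 (by linarith))
  have h4 : (c' - b') * ((c + Q + v - (a - u)) * (P * Q)) ≤
      (c - (a + P)) * ((c + Q - a) * ((b' - (a - u)) * (c + Q + v - c'))) := by
    refine mul_le_mul (by linarith) h3 ?_ (by linarith)
    exact mul_nonneg (by linarith) (by positivity)
  calc _ = (c' - b') * ((c + Q + v - (a - u)) * (P * Q)) := by ring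
    _ ≤ _ := h4
    _ = _ := by ring

lemma CrossExpands.trans {a b c d a' b' c' d' a'' b'' c'' d'' : ℝ}
    (h : CrossExpands a b c d a' b' c' d') (h' : CrossExpands a' b' c' d' a'' b'' c'' d'')
    (hM : 0 < (b - a) * (d - c)) (hM' : 0 < (b' - a') * (d' - c'))
    (hM'' : 0 < (b'' - a'') * (d'' - c'')) : CrossExpands a b c d a'' b'' c'' d'' := by
  unfold CrossExpands at *
  refine lt_of_mul_lt_mul_left ?_ hM'.le
  have h4 := mul_lt_mul_of_pos_right h' hM
  have h5 := mul_lt_mul_of_pos_right h hM''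
  linarith

/-! ### Monotone orbits -/

lemma tendsto_iterate_of_le {g : ℝ → ℝ} (hg : Continuous g) {x p : ℝ} (hxp : x ≤ p)
    (hmaps : ∀ y ∈ Set.Icc x p, y ≤ g y ∧ g y ≤ p)
    (huniq : ∀ y ∈ Set.Icc x p, g y = y → y = p) :
    Tendsto (fun n : ℕ => g^[n] x) atTop (nhds p) := by
  have hmem : ∀ n, g^[n] x ∈ Set.Icc x p := by
    intro n
    induction n with
    | zero => exact ⟨le_rfl, hxp⟩
    | succ n ih =>
      rw [Function.iterate_succ_apply']
      exact ⟨ih.1.trans (hmaps _ ih).1, (hmaps _ ih).2⟩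
  have hmono : Monotone fun n : ℕ => g^[n] x := by
    refine monotone_nat_of_le_succ fun n => ?_
    rw [Function.iterate_succ_apply']
    exact (hmaps _ (hmem n)).1
  have hlim := tendsto_atTop_ciSup hmono ⟨p, by rintro _ ⟨n, rfl⟩; exact (hmem n).2⟩
  have hfix := isFixedPt_of_tendsto_iterate hlim hg.continuousAt
  have hL := isClosed_Icc.mem_of_tendsto hlim (Eventually.of_forall hmem)
  rwa [huniq _ hL hfix] at hlim

lemma tendsto_iterate_of_ge {g : ℝ → ℝ} (hg : Continuous g) {x p : ℝ} (hpx : p ≤ x)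
    (hmaps : ∀ y ∈ Set.Icc p x, p ≤ g y ∧ g y ≤ y)
    (huniq : ∀ y ∈ Set.Icc p x, g y = y → y = p) :
    Tendsto (fun n : ℕ => g^[n] x) atTop (nhds p) := by
  have hmem : ∀ n, g^[n] x ∈ Set.Icc p x := by
    intro n
    induction n with
    | zero => exact ⟨hpx, le_rfl⟩
    | succ n ih =>
      rw [Function.iterate_succ_apply']
      exact ⟨(hmaps _ ih).1, (hmaps _ ih).2.trans ih.2⟩
  have hanti : Antitone fun n : ℕ => g^[n] x := by
    refine antitone_nat_of_succ_le fun n => ?_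
    rw [Function.iterate_succ_apply']
    exact (hmaps _ (hmem n)).2
  have hlim := tendsto_atTop_ciInf hanti ⟨p, by rintro _ ⟨n, rfl⟩; exact (hmem n).1⟩
  have hfix := isFixedPt_of_tendsto_iterate hlim hg.continuousAt
  have hL := isClosed_Icc.mem_of_tendsto hlim (Eventually.of_forall hmem)
  rwa [huniq _ hL hfix] at hlim

lemma tendsto_iterate_of_tendsto_iterate_apply {g : ℝ → ℝ} {x p : ℝ} (n : ℕ)
    (h : Tendsto (fun k : ℕ => g^[k] (g^[n] x)) atTop (nhds p)) :
    Tendsto (fun k : ℕ => g^[k] x) atTop (nhds p) := by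
  simp only [← Function.iterate_add_apply] at h
  exact (tendsto_add_atTop_iff_nat n).1 h

/-! ### Fixed points of the `q`-deformed logistic map -/

section

variable {q r p : ℝ}

lemma Phi_no_sign_pattern (hq : 0 < q) (hq1 : q ≠ 1) (hr : 0 < r) {b c d : ℝ} (h0b : 0 < b)
    (hbc : b < c) (hcd : c < d) (hd2 : d ≤ 1 / 2) (hb : b ≤ Phi q r b) (hc : Phi q r c ≤ c)
    (hd : d ≤ Phi q r d) : False := by
  exact not_crossExpands h0b hbc hcd Phi_zero.le hb hc hd
    (Phi_crossExpands hq hq1 hr h0b hbc hcd (Or.inl hd2))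

lemma exists_lt_Phi_of_not_LAS (hq : 0 < q) (hq1 : q ≠ 1) (hr : 0 < r)
    (h : ¬ LAS (Phi q r) 0) {δ : ℝ} (hδ : 0 < δ) : ∃ x, 0 < x ∧ x < δ ∧ x < Phi q r x := by
  by_contra! hcon
  apply h
  have hmaps : ∀ x, 0 ≤ x → x < min δ (1 / 2) → 0 ≤ Phi q r x ∧ Phi q r x ≤ x := by
    intro x hx hx'
    rw [lt_min_iff] at hx'
    rcases eq_or_lt_of_le hx with rfl | hx0
    · simp [Phi_zero]
    · exact ⟨(Phi_pos hq hq1 hr ⟨hx0, by linarith⟩).le, hcon x hx0 hx'.1⟩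
  have hδ2 : 0 < min δ (1 / 2) := lt_min hδ (by norm_num)
  refine ⟨fun ε hε => ?_, ?_⟩
  · refine ⟨Set.Iio (min ε (min δ (1 / 2))),
      mem_nhdsWithin_of_mem_nhds (Iio_mem_nhds (lt_min hε hδ2)), ?_⟩
    rintro x ⟨hxV, hx⟩ n
    obtain ⟨hxε, hxδ⟩ := lt_min_iff.1 (Set.mem_Iio.1 hxV)
    have hmem : 0 ≤ (Phi q r)^[n] x ∧ (Phi q r)^[n] x ≤ x := by
      induction n with
      | zero => exact ⟨hx.1, le_rfl⟩
      | succ n ih =>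
        rw [Function.iterate_succ_apply']
        have := hmaps _ ih.1 (ih.2.trans_lt hxδ)
        exact ⟨this.1, this.2.trans ih.2⟩
    rw [sub_zero, abs_of_nonneg hmem.1]
    exact hmem.2.trans_lt hxε
  · obtain ⟨η, hη, hηfix⟩ : ∃ η > 0, ∀ x, 0 < x → x < η → Phi q r x ≠ x := by
      by_contra! hacc
      obtain ⟨d, hd0, hd, hdf⟩ := hacc _ hδ2
      obtain ⟨c, hc0, hc, hcf⟩ := hacc d hd0
      obtain ⟨b, hb0, hb, hbf⟩ := hacc c hc0
      exact Phi_no_sign_pattern hq hq1 hr hb0 hb hc (lt_min_iff.1 hd).2.le hbf.ge hcf.le hdf.ge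
    refine ⟨Set.Iio (min η (min δ (1 / 2))),
      mem_nhdsWithin_of_mem_nhds (Iio_mem_nhds (lt_min hη hδ2)), ?_⟩
    rintro x ⟨hxV, hx⟩
    obtain ⟨hxη, hxδ⟩ := lt_min_iff.1 (Set.mem_Iio.1 hxV)
    refine tendsto_iterate_of_ge (continuous_Phi hq) hx.1
      (fun y hy => hmaps y hy.1 (hy.2.trans_lt hxδ)) fun y hy hyf => ?_
    by_contra hy0
    exact hηfix y (lt_of_le_of_ne hy.1 (Ne.symm hy0)) (hy.2.trans_lt hxη) hyf

lemma lt_Phi_of_lt_fixed (hq : 0 < q) (hq1 : q ≠ 1) (hr : 0 < r) (hfix : Phi q r p = p)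
    (h : ¬ LAS (Phi q r) 0) {t : ℝ} (ht : 0 < t) (htp : t < p) : t < Phi q r t := by
  by_contra! hcon
  obtain ⟨x, hx0, hxt, hx⟩ := exists_lt_Phi_of_not_LAS hq hq1 hr h ht
  rcases le_or_gt p (1 / 2) with hp2 | hp2
  · exact Phi_no_sign_pattern hq hq1 hr hx0 hxt htp hp2 hx.le hcon hfix.ge
  · rcases lt_or_ge t (1 / 2) with ht2 | ht2
    · refine Phi_no_sign_pattern hq hq1 hr hx0 hxt ht2 le_rfl hx.le hcon ?_
      have := Phi_le_Phi_half hq hq1 hr p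
      linarith
    · have := Phi_strictAntiOn hq hq1 hr ht2 hp2.le htp
      linarith

lemma Phi_lt_of_fixed_lt (hq : 0 < q) (hq1 : q ≠ 1) (hr : 0 < r) (hp : 0 < p)
    (hfix : Phi q r p = p) (h : ¬ LAS (Phi q r) 0) {t : ℝ} (htp : p < t) : Phi q r t < t := by
  by_contra! hcon
  obtain ⟨x, hx0, hxp, hx⟩ := exists_lt_Phi_of_not_LAS hq hq1 hr h hp
  rcases le_or_gt (1 / 2) p with hp2 | hp2
  · have := Phi_strictAntiOn hq hq1 hr hp2 (hp2.trans htp.le) htp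
    linarith
  · rcases le_or_gt t (1 / 2) with ht2 | ht2
    · exact Phi_no_sign_pattern hq hq1 hr hx0 hxp htp ht2 hx.le hfix.le hcon
    · refine Phi_no_sign_pattern hq hq1 hr hx0 hxp hp2 le_rfl hx.le hfix.le ?_
      have := Phi_le_Phi_half hq hq1 hr t
      linarith

/-! ### The fixed point on the increasing branch -/

lemma tendsto_iterate_of_fixed_le_half (hq : 0 < q) (hq1 : q ≠ 1) (hr : 0 < r) (hp : 0 < p)
    (hp2 : p ≤ 1 / 2) (hfix : Phi q r p = p) (h : ¬ LAS (Phi q r) 0) {x : ℝ}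
    (hx : x ∈ Set.Ioo (0 : ℝ) 1) : Tendsto (fun n : ℕ => (Phi q r)^[n] x) atTop (nhds p) := by
  have hmono := (Phi_strictMonoOn hq hq1 hr).monotoneOn
  have hhalf : Phi q r (1 / 2) ≤ 1 / 2 := by
    rcases eq_or_lt_of_le hp2 with rfl | hlt
    · exact hfix.le
    · exact (Phi_lt_of_fixed_lt hq hq1 hr hp hfix h hlt).le
  have hy2 : Phi q r x ≤ 1 / 2 := (Phi_le_Phi_half hq hq1 hr x).trans hhalf
  have hy0 := Phi_pos hq hq1 hr hx
  refine tendsto_iterate_of_tendsto_iterate_apply 1 ?_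
  rw [Function.iterate_one]
  rcases le_total (Phi q r x) p with hle | hle
  · refine tendsto_iterate_of_le (continuous_Phi hq) hle (fun y hy => ⟨?_, ?_⟩) fun y hy hyf => ?_
    · rcases eq_or_lt_of_le hy.2 with rfl | hlt
      · exact hfix.ge
      · exact (lt_Phi_of_lt_fixed hq hq1 hr hfix h (hy0.trans_le hy.1) hlt).le
    · exact (hmono (hy.2.trans hp2) hp2 hy.2).trans hfix.le
    · by_contra hne
      exact (lt_Phi_of_lt_fixed hq hq1 hr hfix h (hy0.trans_le hy.1)
        (lt_of_le_of_ne hy.2 hne)).ne' hyf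
  · refine tendsto_iterate_of_ge (continuous_Phi hq) hle (fun y hy => ⟨?_, ?_⟩) fun y hy hyf => ?_
    · exact hfix.ge.trans (hmono hp2 (hy.2.trans hy2) hy.1)
    · rcases eq_or_lt_of_le hy.1 with rfl | hlt
      · exact hfix.le
      · exact (Phi_lt_of_fixed_lt hq hq1 hr hp hfix h hlt).le
    · by_contra hne
      exact (Phi_lt_of_fixed_lt hq hq1 hr hp hfix h
        (lt_of_le_of_ne hy.1 (Ne.symm hne))).ne hyf

/-! ### The fixed point on the decreasing branch -/

lemma Phi_Phi_monotoneOn (hq : 0 < q) (hq1 : q ≠ 1) (hr : 0 < r) (hp2 : 1 / 2 < p)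
    (hfix : Phi q r p = p) :
    StrictMonoOn (fun x => Phi q r (Phi q r x)) (Set.Icc (1 / 2) p) := by
  have hanti := Phi_strictAntiOn hq hq1 hr
  have hge : ∀ x ∈ Set.Icc (1 / 2) p, 1 / 2 ≤ Phi q r x := by
    intro x hx
    have := hanti.antitoneOn hx.1 (hx.1.trans hx.2) hx.2
    linarith
  exact fun x hx y hy hxy => hanti (hge y hy) (hge x hx) (hanti hx.1 hy.1 hxy)

lemma exists_lt_Phi_Phi_of_LAS (hq : 0 < q) (hq1 : q ≠ 1) (hr : 0 < r) (hp2 : 1 / 2 < p)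
    (hp1 : p < 1) (hfix : Phi q r p = p) (hlas : LAS (Phi q r) p) {y : ℝ} (hy2 : 1 / 2 ≤ y)
    (hyp : y < p) : ∃ b, y < b ∧ b < p ∧ b < Phi q r (Phi q r b) := by
  obtain ⟨hstab, W, hW, hattr⟩ := hlas
  obtain ⟨V, hV, hstab⟩ := hstab (p - 1 / 2) (by linarith)
  have hnhds : Set.Icc (0 : ℝ) 1 ∈ nhds p := Icc_mem_nhds (by linarith) hp1
  rw [nhdsWithin_eq_nhds.2 hnhds] at hW hV
  have hev : ∀ᶠ b in nhdsWithin p (Set.Iio p), b ∈ V ∧ b ∈ W ∧ b ∈ Set.Icc (0 : ℝ) 1 ∧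
      b ∈ Set.Ioo y p :=
    inter_mem (mem_nhdsWithin_of_mem_nhds hV) (inter_mem (mem_nhdsWithin_of_mem_nhds hW)
      (inter_mem (mem_nhdsWithin_of_mem_nhds hnhds) (Ioo_mem_nhdsLT hyp)))
  obtain ⟨b, hbV, hbW, hbI, hyb, hbp⟩ := hev.exists
  refine ⟨b, hyb, hbp, ?_⟩
  by_contra! hcon
  have hle : ∀ n : ℕ, (Phi q r)^[2 * n] b ≤ b := by
    intro n
    induction n with
    | zero => simp
    | succ n ih =>
      rw [mul_add, mul_one, Function.iterate_succ_apply', Function.iterate_succ_apply']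
      refine le_trans ((Phi_Phi_monotoneOn hq hq1 hr hp2 hfix).monotoneOn ⟨?_, ih.trans hbp.le⟩
        ⟨hy2.trans hyb.le, hbp.le⟩ ih) hcon
      have := (abs_lt.1 (hstab b ⟨hbV, hbI⟩ (2 * n))).1
      linarith
  have hlim := (hattr b ⟨hbW, hbI⟩).comp (tendsto_id.const_mul_atTop' (by norm_num : 0 < 2))
  exact absurd (le_of_tendsto' hlim hle) (not_le.2 hbp)

lemma lt_Phi_Phi_of_LAS (hq : 0 < q) (hq1 : q ≠ 1) (hr : 0 < r) (hp2 : 1 / 2 < p)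
    (hp1 : p < 1) (hfix : Phi q r p = p) (hlas : LAS (Phi q r) p) {y : ℝ} (hy2 : 1 / 2 ≤ y)
    (hyp : y < p) : y < Phi q r (Phi q r y) := by
  by_contra! hcon
  obtain ⟨b, hyb, hbp, hb⟩ := exists_lt_Phi_Phi_of_LAS hq hq1 hr hp2 hp1 hfix hlas hy2 hyp
  have hcont := continuous_Phi (r := r) hq
  obtain ⟨a, ⟨hya, hab⟩, ha⟩ : ∃ a ∈ Set.Icc y b, Phi q r (Phi q r a) - a = 0 :=
    intermediate_value_Icc hyb.le ((hcont.comp hcont).sub continuous_id).continuousOn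
      ⟨sub_nonpos.2 hcon, (sub_pos.2 hb).le⟩
  have haf : Phi q r (Phi q r a) = a := sub_eq_zero.1 ha
  have hab : a < b := lt_of_le_of_ne hab (by rintro rfl; exact hb.ne' haf)
  have hanti := Phi_strictAntiOn hq hq1 hr
  have hmono := Phi_Phi_monotoneOn hq hq1 hr hp2 hfix
  have ha2 : 1 / 2 ≤ a := hy2.trans hya
  have hb2 : 1 / 2 ≤ b := ha2.trans hab.le
  have hpc : p < Phi q r b := hfix.symm.trans_lt (hanti hb2 hp2.le hbp)
  have hcd : Phi q r b < Phi q r a := hanti ha2 hb2 hab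
  have hbc : b < Phi q r b := hbp.trans hpc
  have hhb : Phi q r (Phi q r b) < p :=
    (hmono ⟨hb2, hbp.le⟩ ⟨hp2.le, le_rfl⟩ hbp).trans_eq (by simp only [hfix])
  have hc : Phi q r (Phi q r (Phi q r b)) < Phi q r b := hanti hb2 (hb2.trans hb.le) hb
  have e1 := Phi_crossExpands hq hq1 hr hab hbc hcd (Or.inr ha2)
  have hd1 : Phi q r (Phi q r b) < Phi q r b := hhb.trans hpc
  have hab' : a < Phi q r (Phi q r b) := hab.trans hb
  have e2 := Phi_crossExpands hq hq1 hr hab' hd1 hcd (Or.inr ha2)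
  rw [haf] at e1 e2
  have e2' : CrossExpands (Phi q r a) (Phi q r b) (Phi q r (Phi q r b)) a
      a (Phi q r (Phi q r b)) (Phi q r (Phi q r (Phi q r b))) (Phi q r a) := by
    unfold CrossExpands at e2 ⊢
    linarith
  refine not_crossExpands hab hbc hcd le_rfl hb.le hc.le le_rfl
    (e1.trans e2' ?_ ?_ ?_)
  · exact mul_pos (sub_pos.2 hab) (sub_pos.2 hcd)
  · exact mul_pos_of_neg_of_neg (sub_neg.2 hcd) (sub_neg.2 hab')
  · exact mul_pos (sub_pos.2 hab') (sub_pos.2 (hc.trans hcd))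

lemma exists_iterate_half_le (hq : 0 < q) (hq1 : q ≠ 1) (hr : 0 < r) (hp2 : 1 / 2 < p)
    (hfix : Phi q r p = p) (h : ¬ LAS (Phi q r) 0) {x : ℝ} (hx : 0 < x) :
    ∃ n : ℕ, 1 / 2 ≤ (Phi q r)^[n] x := by
  by_contra! hcon
  have hlt : ∀ y, 0 < y → y ≤ 1 / 2 → y < Phi q r y := fun y hy0 hy2 =>
    lt_Phi_of_lt_fixed hq hq1 hr hfix h hy0 (hy2.trans_lt hp2)
  have hge : ∀ n : ℕ, x ≤ (Phi q r)^[n] x := by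
    intro n
    induction n with
    | zero => exact le_rfl
    | succ n ih =>
      rw [Function.iterate_succ_apply']
      exact ih.trans (hlt _ (hx.trans_le ih) (hcon n).le).le
  have hmono : Monotone fun n : ℕ => (Phi q r)^[n] x := by
    refine monotone_nat_of_le_succ fun n => ?_
    rw [Function.iterate_succ_apply']
    exact (hlt _ (hx.trans_le (hge n)) (hcon n).le).le
  have hlim := tendsto_atTop_ciSup hmono ⟨1 / 2, by rintro _ ⟨n, rfl⟩; exact (hcon n).le⟩
  have hL := isFixedPt_of_tendsto_iterate hlim (continuous_Phi hq).continuousAt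
  exact (hlt _ (hx.trans_le (ge_of_tendsto' hlim hge))
    (le_of_tendsto' hlim fun n => (hcon n).le)).ne' hL

lemma tendsto_iterate_of_half_le_of_le (hq : 0 < q) (hq1 : q ≠ 1) (hr : 0 < r)
    (hp2 : 1 / 2 < p) (hp1 : p < 1) (hfix : Phi q r p = p) (hlas : LAS (Phi q r) p) {x : ℝ}
    (hx2 : 1 / 2 ≤ x) (hxp : x ≤ p) :
    Tendsto (fun n : ℕ => (Phi q r)^[n] x) atTop (nhds p) := by
  have hcont := continuous_Phi (r := r) hq
  have hmono := (Phi_Phi_monotoneOn hq hq1 hr hp2 hfix).monotoneOn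
  have hlt : ∀ y ∈ Set.Icc x p, y ≠ p → y < Phi q r (Phi q r y) := fun y hy hne =>
    lt_Phi_Phi_of_LAS hq hq1 hr hp2 hp1 hfix hlas (hx2.trans hy.1) (lt_of_le_of_ne hy.2 hne)
  have hlim : Tendsto (fun n : ℕ => (fun y => Phi q r (Phi q r y))^[n] x) atTop (nhds p) := by
    refine tendsto_iterate_of_le (hcont.comp hcont) hxp (fun y hy => ⟨?_, ?_⟩) fun y hy hyf => ?_
    · rcases eq_or_ne y p with rfl | hne
      · simp [hfix]
      · exact (hlt y hy hne).le
    · exact (hmono ⟨hx2.trans hy.1, hy.2⟩ ⟨hp2.le, le_rfl⟩ hy.2).trans (by simp only [hfix, le_refl])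
    · by_contra hne
      exact (hlt y hy hne).ne' hyf
  obtain ⟨-, W, hW, hattr⟩ := hlas
  have hnhds : Set.Icc (0 : ℝ) 1 ∈ nhds p := Icc_mem_nhds (by linarith) hp1
  rw [nhdsWithin_eq_nhds.2 hnhds] at hW
  obtain ⟨n, hn⟩ := (hlim.eventually (inter_mem hW hnhds)).exists
  refine tendsto_iterate_of_tendsto_iterate_apply (2 * n) (hattr _ ?_)
  rw [Function.iterate_mul]
  exact hn

lemma tendsto_iterate_of_half_lt_fixed (hq : 0 < q) (hq1 : q ≠ 1) (hr : 0 < r)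
    (hp2 : 1 / 2 < p) (hp1 : p < 1) (hfix : Phi q r p = p)
    (hlas : LAS (Phi q r) p) (h : ¬ LAS (Phi q r) 0) {x : ℝ}
    (hx : x ∈ Set.Ioo (0 : ℝ) 1) : Tendsto (fun n : ℕ => (Phi q r)^[n] x) atTop (nhds p) := by
  have hanti := (Phi_strictAntiOn hq hq1 hr).antitoneOn
  refine tendsto_iterate_of_tendsto_iterate_apply 1 ?_
  rw [Function.iterate_one]
  obtain ⟨n, hn⟩ := exists_iterate_half_le hq hq1 hr hp2 hfix h (Phi_pos hq hq1 hr hx)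
  refine tendsto_iterate_of_tendsto_iterate_apply n ?_
  have hM : (Phi q r)^[n] (Phi q r x) ≤ Phi q r (1 / 2) := by
    rw [← Function.iterate_succ_apply, Function.iterate_succ_apply']
    exact Phi_le_Phi_half hq hq1 hr _
  generalize (Phi q r)^[n] (Phi q r x) = y at hn hM
  rcases le_total y p with hy | hy
  · exact tendsto_iterate_of_half_le_of_le hq hq1 hr hp2 hp1 hfix hlas hn hy
  · refine tendsto_iterate_of_tendsto_iterate_apply 1 ?_
    rw [Function.iterate_one]
    refine tendsto_iterate_of_half_le_of_le hq hq1 hr hp2 hp1 hfix hlas ?_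
      ((hanti hp2.le hn hy).trans hfix.le)
    have h1 := lt_Phi_Phi_of_LAS hq hq1 hr hp2 hp1 hfix hlas le_rfl hp2
    exact h1.le.trans (hanti hn (hn.trans hM) hM)

end

/-- If `p ∈ (0,1)` is a LAS fixed point of `Φ_{q,r}`, then `p` is GAS (all orbits from
`(0,1)` converge to `p`) if and only if the fixed point `0` is not LAS. -/
theorem stmt_11 (q r : ℝ) (hq : 0 < q) (hq1 : q ≠ 1) (hr : 0 < r) (hr4 : r ≤ 4)
    (p : ℝ) (hp : p ∈ Set.Ioo (0:ℝ) 1) (hfix : Phi q r p = p)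
    (hlas : LAS (Phi q r) p) :
    (∀ x ∈ Set.Ioo (0:ℝ) 1,
        Filter.Tendsto (fun n : ℕ => (Phi q r)^[n] x) Filter.atTop (nhds p)) ↔
      ¬ LAS (Phi q r) 0 := by
  constructor
  · rintro hgas ⟨-, V, hV, hattr⟩
    have hev : ∀ᶠ x in nhdsWithin (0 : ℝ) (Set.Ioo 0 1), x ∈ V ∧ x ∈ Set.Ioo (0 : ℝ) 1 :=
      inter_mem (nhdsWithin_mono 0 Set.Ioo_subset_Icc_self hV) self_mem_nhdsWithin
    have : (nhdsWithin (0 : ℝ) (Set.Ioo 0 1)).NeBot := left_nhdsWithin_Ioo_neBot one_pos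
    obtain ⟨x, hxV, hx⟩ := hev.exists
    exact hp.1.ne (tendsto_nhds_unique (hattr x ⟨hxV, Set.Ioo_subset_Icc_self hx⟩) (hgas x hx))
  · intro h x hx
    rcases le_or_gt p (1 / 2) with hp2 | hp2
    · exact tendsto_iterate_of_fixed_le_half hq hq1 hr hp.1 hp2 hfix h hx
    · exact tendsto_iterate_of_half_lt_fixed hq hq1 hr hp2 hp.2 hfix hlas h hx
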